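/- Let p be a prime, G = ℤ/pℤ, and k a field of characteristic not equal to p. Let V be a finite-dimensional representation of G over k such that the base change of V to an algebraic closure of k contains at least 3 distinct nontrivial characters of G. Then β^r(G,V) ≤ (p+3)/2. -/

import Mathlib

open MvPolynomial

noncomputable section

variable {k : Type} [Field k] {N : ℕ} {G : Type}

def mAct (M : Matrix (Fin N) (Fin N) k) :
    MvPolynomial (Fin N) k →ₐ[k] MvPolynomial (Fin N) k :=
  aeval fun i => ∑ j, C (M i j) * X j

lemma mAct_comp (A B : Matrix (Fin N) (Fin N) k) :
    (mAct A).comp (mAct B) = mAct (B * A) := by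
  apply MvPolynomial.algHom_ext
  intro i
  simp only [mAct, AlgHom.comp_apply, aeval_X, map_sum, map_mul, aeval_C, algebraMap_eq,
    Finset.mul_sum, Matrix.mul_apply, Finset.sum_mul]
  rw [Finset.sum_comm]
  simp [mul_assoc]

lemma mAct_one : mAct (1 : Matrix (Fin N) (Fin N) k) = AlgHom.id k _ := by
  apply MvPolynomial.algHom_ext
  intro i
  simp [mAct, Matrix.one_apply, ite_mul, apply_ite C]

def mEquiv (M : GL (Fin N) k) :
    MvPolynomial (Fin N) k ≃ₐ[k] MvPolynomial (Fin N) k :=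
  AlgEquiv.ofAlgHom (mAct (M : Matrix (Fin N) (Fin N) k))
    (mAct ((M⁻¹ : GL (Fin N) k) : Matrix (Fin N) (Fin N) k))
    (by rw [mAct_comp, Units.inv_mul, mAct_one])
    (by rw [mAct_comp, Units.mul_inv, mAct_one])

def fAct (M : GL (Fin N) k) :
    FractionRing (MvPolynomial (Fin N) k) ≃+* FractionRing (MvPolynomial (Fin N) k) :=
  IsFractionRing.ringEquivOfRingEquiv (mEquiv M).toRingEquiv

/-- `f` is an invariant rational function for the linear action `ρ`. -/
def IsInv (ρ : G → GL (Fin N) k) (f : FractionRing (MvPolynomial (Fin N) k)) : Prop :=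
  ∀ g, fAct (ρ g) f = f

/-- `f`, written as a quotient `f₁/f₂` of coprime polynomials, has
`deg f = deg f₁ + deg f₂ ≤ d`. -/
def RDegLE (f : FractionRing (MvPolynomial (Fin N) k)) (d : ℕ) : Prop :=
  ∃ f₁ f₂ : MvPolynomial (Fin N) k, f₂ ≠ 0 ∧
    (∀ p : MvPolynomial (Fin N) k, p ∣ f₁ → p ∣ f₂ → IsUnit p) ∧
    f = algebraMap (MvPolynomial (Fin N) k) (FractionRing (MvPolynomial (Fin N) k)) f₁ /
        algebraMap (MvPolynomial (Fin N) k) (FractionRing (MvPolynomial (Fin N) k)) f₂ ∧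
    f₁.totalDegree + f₂.totalDegree ≤ d

/-- `f` is (the image in `k(V)` of) a polynomial of degree at most `d`. -/
def PDegLE (f : FractionRing (MvPolynomial (Fin N) k)) (d : ℕ) : Prop :=
  ∃ p : MvPolynomial (Fin N) k, p.totalDegree ≤ d ∧
    f = algebraMap (MvPolynomial (Fin N) k) (FractionRing (MvPolynomial (Fin N) k)) p

/-- `β^r(G,V)`: the least `d` such that the invariant rational functions of degree at most `d`
generate the invariant field over `k`. -/
def betaR (ρ : G → GL (Fin N) k) : ℕ :=
  sInf {d : ℕ | ∀ f, IsInv ρ f →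
    f ∈ IntermediateField.adjoin k {h | IsInv ρ h ∧ RDegLE h d}}

/-- `β(G,V)`: the least `d` such that the invariant polynomials of degree at most `d`
generate the invariant field over `k`. -/
def betaP (ρ : G → GL (Fin N) k) : ℕ :=
  sInf {d : ℕ | ∀ f, IsInv ρ f →
    f ∈ IntermediateField.adjoin k {h | IsInv ρ h ∧ PDegLE h d}}

/-- `γ^r(G,V)`: the least `d` such that the invariant rational functions of degree at most `d`
contain a transcendence basis for the invariant field over `k`. -/
def gammaR (ρ : G → GL (Fin N) k) : ℕ :=
  sInf {d : ℕ | ∃ s : Set (FractionRing (MvPolynomial (Fin N) k)),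
    (∀ f ∈ s, IsInv ρ f ∧ RDegLE f d) ∧
    AlgebraicIndependent k ((↑) : s → FractionRing (MvPolynomial (Fin N) k)) ∧
    ∀ f, IsInv ρ f → IsAlgebraic (IntermediateField.adjoin k s) f}

/-- `γ(G,V)`: the least `d` such that the invariant polynomials of degree at most `d`
contain a transcendence basis for the invariant field over `k`. -/
def gammaP (ρ : G → GL (Fin N) k) : ℕ :=
  sInf {d : ℕ | ∃ s : Set (FractionRing (MvPolynomial (Fin N) k)),
    (∀ f ∈ s, IsInv ρ f ∧ PDegLE f d) ∧
    AlgebraicIndependent k ((↑) : s → FractionRing (MvPolynomial (Fin N) k)) ∧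
    ∀ f, IsInv ρ f → IsAlgebraic (IntermediateField.adjoin k s) f}

/-- The character `χ : G → Lˣ` occurs in the base change to `L` of the representation `ρ`,
i.e. its eigenspace in `L ⊗ V` is nonzero. -/
def Occurs {L : Type} [Field L] [Algebra k L] [Monoid G] (ρ : G → GL (Fin N) k)
    (χ : G →* Lˣ) : Prop :=
  ∃ v : Fin N → L, v ≠ 0 ∧
    ∀ g, ((ρ g : Matrix (Fin N) (Fin N) k).map (algebraMap k L)).mulVec v = (χ g : L) • v

lemma two_letter {U : Type*} [CommGroup U] (p b : ℕ) (hp : p.Prime) (hb : 2 ≤ b) (hbp : b + 2 ≤ p)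
    (u v : U) (hs : ∀ x y : ℕ, 2 * (x + y) ≤ p + 3 → p ∣ x + b * y → u ^ x * v ^ y = 1) :
    v = u ^ b ∧ u ^ p = 1 := by
  have hsuff : v = u ^ b → u ^ p = 1 → v = u ^ b ∧ u ^ p = 1 := fun h1 h2 => ⟨h1, h2⟩
  have hndvd : ¬ b ∣ p := fun h => by
    rcases (Nat.dvd_prime hp).1 h with h | h <;> omega
  have hodd : p % 2 = 1 := by
    rcases hp.eq_two_or_odd with h | h <;> omega
  by_cases hq1 : p < 2 * b
  · -- b = p - s
    obtain ⟨s, hs'⟩ : ∃ s, p = b + s := ⟨p - b, by omega⟩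
    have h1 : u ^ s * v ^ 1 = 1 := hs s 1 (by omega) ⟨1, by omega⟩
    have hst : s * (p / s) + p % s = p := Nat.div_add_mod p s
    have htlt : p % s < s := Nat.mod_lt _ (by omega)
    have ht : 0 < p % s := Nat.pos_of_ne_zero fun h => by
      rcases (Nat.dvd_prime hp).1 (Nat.dvd_of_mod_eq_zero h) with h | h <;> omega
    have hm : 2 ≤ p / s := (Nat.le_div_iff_mul_le (by omega)).2 (by omega)
    generalize p / s = m at *
    generalize p % s = t at *
    obtain ⟨x, hx⟩ : ∃ x, s = t + x := ⟨s - t, by omega⟩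
    have h2 : u ^ x * v ^ (m + 1) = 1 := by
      apply hs
      · have h2s : 2 ≤ s := by omega
        nlinarith [Nat.mul_le_mul hm h2s, mul_nonneg (sub_nonneg.2 (Nat.cast_le (α := ℤ).2 hm)) (sub_nonneg.2 (Nat.cast_le (α := ℤ).2 h2s))]
      · refine ⟨m , ?_⟩
        have hb' : b + s = s * m + t := by omega
        zify at *
        have e1 : (x : ℤ) = s - t := by linarith
        have e2 : (b : ℤ) = s * m + t - s := by linarith
        have e3 : (p : ℤ) = s * m + t := by linarith
        rw [e1, e2, e3]; ring
    have hv : v = (u ^ s)⁻¹ := by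
      rw [pow_one] at h1
      exact eq_inv_of_mul_eq_one_right h1
    have hup : u ^ p = 1 := by
      have : u ^ (s * (m + 1)) = u ^ x := by
        rw [hv, inv_pow, ← pow_mul] at h2
        exact (mul_inv_eq_one.1 h2).symm
      have e : s * (m + 1) = p + x := by
        have := hx; have := hst; nlinarith
      rw [e, pow_add] at this
      exact mul_eq_right.1 this
    refine ⟨?_, hup⟩
    rw [hv, inv_eq_iff_mul_eq_one, ← pow_add, add_comm, ← hs', hup]
  · have hbq : b * (p / b) + p % b = p := Nat.div_add_mod p b
    have hrb : p % b < b := Nat.mod_lt _ (by omega)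
    have hr : 0 < p % b := Nat.pos_of_ne_zero fun h => hndvd (Nat.dvd_of_mod_eq_zero h)
    have hq : 2 ≤ p / b := (Nat.le_div_iff_mul_le (by omega)).2 (by omega)
    generalize p / b = q at *
    generalize p % b = r at *
    by_cases hcase : 3 ≤ q ∨ r = 1
    · obtain ⟨n, rfl⟩ : ∃ n, q = n + 2 := ⟨q - 2, by omega⟩
      obtain ⟨c, rfl⟩ : ∃ c, b = c + 2 := ⟨b - 2, by omega⟩
      have key : r ≤ n * c + 1 := by
        rcases hcase with h | h
        · have : 1 ≤ n := by omega
          nlinarith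
        · omega
      have h1 : u ^ r * v ^ (n + 2) = 1 := hs _ _ (by nlinarith) ⟨1, by nlinarith⟩
      have h2 : u ^ (r + (c + 2)) * v ^ (n + 1) = 1 := hs _ _ (by nlinarith) ⟨1, by nlinarith⟩
      have hv : v = u ^ (c + 2) := by
        have : u ^ r * v ^ (n + 1) * v = u ^ r * v ^ (n + 1) * u ^ (c + 2) := by
          rw [mul_assoc, ← pow_succ, h1, ← h2, pow_add]; 
          simp only [mul_assoc, mul_comm, mul_left_comm]
        exact mul_left_cancel this
      refine ⟨hv, ?_⟩
      rw [hv, ← pow_mul, ← pow_add] at h1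
      rw [← hbq, ← h1]; ring_nf
    · have hq2 : q = 2 := by omega
      subst hq2
      have hr3 : 3 ≤ r := by omega
      -- g = ceil (b / r)
      have hg : r * (b / r) + b % r = b := Nat.div_add_mod b r
      have hgl : b % r < r := Nat.mod_lt _ (by omega)
      have hg0 : 0 < b % r := Nat.pos_of_ne_zero fun h => by
        have h3 : r ∣ b := Nat.dvd_of_mod_eq_zero h
        have h4 : r ∣ p := by rw [← hbq]; exact dvd_add (h3.mul_right _) dvd_rfl
        rcases (Nat.dvd_prime hp).1 h4 with h | h <;> omega
      have hg1 : 1 ≤ b / r := (Nat.le_div_iff_mul_le (by omega)).2 (by omega)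
      generalize b / r = g' at *
      generalize b % r = t at *
      obtain ⟨n, rfl⟩ : ∃ n, g' = n + 1 := ⟨g' - 1, by omega⟩
      obtain ⟨x, hx⟩ : ∃ x, r = t + x := ⟨r - t, by omega⟩
      have hbx : b + x = r * (n + 2) := by nlinarith
      have h1 : u ^ r * v ^ 2 = 1 := hs _ _ (by omega) ⟨1, by omega⟩
      have h2 : u ^ x * v ^ (2 * (n + 2) + 1) = 1 := by
        apply hs
        · obtain ⟨s, rfl⟩ : ∃ s, r = s + 3 := ⟨r - 3, by omega⟩
          nlinarith
        · refine ⟨n + 2, ?_⟩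
          rw [← hbq]; nlinarith
      have h3 : u ^ (b + x) * v ^ (2 * (n + 2)) = 1 := by
        rw [hbx, pow_mul, pow_mul, ← mul_pow, h1, one_pow]
      have hv : v = u ^ b := by
        have : u ^ x * v ^ (2 * (n + 2)) * v = u ^ x * v ^ (2 * (n + 2)) * u ^ b := by
          rw [mul_assoc, ← pow_succ, h2, ← h3, pow_add]
          simp only [mul_assoc, mul_comm]
        exact mul_left_cancel this
      refine ⟨hv, ?_⟩
      rw [hv, ← pow_mul, ← pow_add] at h1
      rw [← hbq, ← h1]; ring_nf

lemma all_letters {U Y : Type*} [CommGroup U] (p : ℕ) (hp : p.Prime) 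
    (e : Y → U) (a : Y → ℕ)
    (hs : ∀ s t x y, 2 * (x + y) ≤ p + 3 → p ∣ a s * x + a t * y → e s ^ x * e t ^ y = 1)
    (s t : Y) (h1 : a s = 1) (hb : 2 ≤ a t) (hbp : a t + 2 ≤ p) (y : Y) (hy : a y < p) :
    e y = e s ^ a y := by
  have key : ∀ s t, a s = 1 → 2 ≤ a t → a t + 2 ≤ p → e t = e s ^ a t ∧ e s ^ p = 1 := by
    intro s t h1 h2 h3
    refine two_letter p (a t) hp h2 h3 _ _ fun x y h h' => hs s t x y h ?_
    rwa [h1, one_mul]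
  have h5 : 4 ≤ p := by omega
  rcases Nat.lt_or_ge (a y) 2 with h | h
  · interval_cases h' : a y
    · have := hs y y 1 0 (by omega) (by simp [h'])
      simpa using this
    · obtain ⟨k1, k2⟩ := key s t h1 hb hbp
      obtain ⟨k3, k4⟩ := key y t h' hb hbp
      have hc : Nat.Coprime p (a t) := ((Nat.Prime.coprime_iff_not_dvd hp).2 (Nat.not_dvd_of_pos_of_lt (by omega) (by omega)))
      rw [pow_one]
      have e1 : (e y / e s) ^ a t = 1 := by rw [div_pow, ← k3, ← k1, div_self']
      have e2 : (e y / e s) ^ p = 1 := by rw [div_pow, k2, k4, div_self']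
      have e3 := orderOf_dvd_of_pow_eq_one e1
      have e4 := orderOf_dvd_of_pow_eq_one e2
      have e5 := Nat.dvd_gcd e4 e3
      rw [hc] at e5
      have := orderOf_eq_one_iff.1 (Nat.dvd_one.1 e5)
      exact div_eq_one.1 this
  · rcases Nat.lt_or_ge p (a y + 2) with h' | h'
    · have ha : a y + 1 = p := by omega
      have k := hs s y 1 1 (by omega) ⟨1, by rw [h1]; omega⟩
      have k2 := (key s t h1 hb hbp).2
      rw [← ha, pow_succ, mul_comm] at k2
      simp only [pow_one] at k
      exact mul_left_cancel (k.trans k2.symm)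
    · exact (key s y h1 h h').1


lemma exists_compositum {k F K E : Type*} [Field k] [Field F] [Field K] [Field E] [Algebra k F]
    [Algebra k K] [Algebra.IsAlgebraic k K] (j : F →+* E) (i : K →+* E)
    (hji : ∀ c : k, j (algebraMap k F c) = i (algebraMap k K c)) (F' : IntermediateField k F) :
    ∃ L : Subfield E, (∀ c, i c ∈ L) ∧ (∀ a ∈ F', j a ∈ L) ∧
      ∀ z ∈ L, z ∈ AddSubgroup.closure {w | ∃ c, ∃ a ∈ F', w = i c * j a} := by
  let _ : Algebra F' E := (j.comp (algebraMap F' F)).toAlgebra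
  have halg : ∀ a : F', algebraMap F' E a = j a := fun a => rfl
  refine ⟨(IntermediateField.adjoin F' (Set.range i)).toSubfield, ?_, ?_, ?_⟩
  · intro c
    exact IntermediateField.subset_adjoin _ _ ⟨c, rfl⟩
  · intro a ha
    exact IntermediateField.algebraMap_mem (IntermediateField.adjoin F' (Set.range i)) ⟨a, ha⟩
  · intro z hz
    have hS : ∀ x ∈ Set.range i, IsAlgebraic F' x := by
      rintro _ ⟨c, rfl⟩
      obtain ⟨q, hq0, hq⟩ := Algebra.IsAlgebraic.isAlgebraic (R := k) c
      refine ⟨q.map (algebraMap k F'), ?_, ?_⟩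
      · rwa [Ne, Polynomial.map_eq_zero]
      · rw [Polynomial.aeval_def, Polynomial.eval₂_map]
        have : (algebraMap F' E).comp (algebraMap k F') = i.comp (algebraMap k K) := by
          ext c; exact hji c
        rw [this, ← Polynomial.hom_eval₂, ← Polynomial.aeval_def, hq, map_zero]
    have hz' : z ∈ (IntermediateField.adjoin F' (Set.range i)).toSubalgebra := hz
    rw [IntermediateField.adjoin_toSubalgebra_of_isAlgebraic hS] at hz'
    have hz2 : z ∈ Subalgebra.toSubmodule (Algebra.adjoin F' (Set.range i)) := hz'
    rw [Algebra.adjoin_eq_span] at hz2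
    have hcl : (Submonoid.closure (Set.range i) : Set E) = Set.range i := by
      have : Set.range i = (MonoidHom.mrange (i : K →* E) : Set E) := by ext; simp
      rw [this, Submonoid.closure_eq]
    rw [hcl] at hz2
    clear hz hz' hS hcl
    induction hz2 using Submodule.span_induction with
    | mem x hx =>
      obtain ⟨c, rfl⟩ := hx
      exact AddSubgroup.subset_closure ⟨c, 1, one_mem _, by simp⟩
    | zero => exact zero_mem _
    | add x y _ _ hx hy => exact add_mem hx hy
    | smul a x h0 hx =>
      clear h0
      induction hx using AddSubgroup.closure_induction with
      | mem x hx =>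
        obtain ⟨c, b, hb, rfl⟩ := hx
        refine AddSubgroup.subset_closure ⟨c, a * b, mul_mem a.2 hb, ?_⟩
        rw [Algebra.smul_def, halg, map_mul]; ring
      | zero => simp
      | add x y _ _ hx hy => rw [smul_add]; exact add_mem hx hy
      | neg x _ hx => rw [smul_neg]; exact neg_mem hx

/-- coefficientwise functional -/
noncomputable def coefL {k K σ : Type*} [Field k] [Field K] [Algebra k K] (l : K →ₗ[k] k)
    (P : MvPolynomial σ K) : MvPolynomial σ k := ∑ m ∈ P.support, monomial m (l (coeff m P))

lemma coeff_coefL {k K σ : Type*} [Field k] [Field K] [Algebra k K] (l : K →ₗ[k] k)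
    (P : MvPolynomial σ K) (m : σ →₀ ℕ) : coeff m (coefL l P) = l (coeff m P) := by
  classical
  simp only [coefL, coeff_sum, coeff_monomial]
  rw [Finset.sum_ite_eq']
  split_ifs with h
  · rfl
  · rw [notMem_support_iff.1 h, map_zero]

lemma coefL_add {k K σ : Type*} [Field k] [Field K] [Algebra k K] (l : K →ₗ[k] k)
    (P Q : MvPolynomial σ K) : coefL l (P + Q) = coefL l P + coefL l Q := by
  ext m; simp [coeff_coefL]

lemma coefL_neg {k K σ : Type*} [Field k] [Field K] [Algebra k K] (l : K →ₗ[k] k)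
    (P : MvPolynomial σ K) : coefL l (-P) = - coefL l P := by
  ext m; simp [coeff_coefL]

lemma coefL_zero {k K σ : Type*} [Field k] [Field K] [Algebra k K] (l : K →ₗ[k] k) :
    coefL l (0 : MvPolynomial σ K) = 0 := by
  ext m; simp [coeff_coefL]

lemma coefL_mul {k K σ : Type*} [Field k] [Field K] [Algebra k K] (l : K →ₗ[k] k)
    (P : MvPolynomial σ K) (Q : MvPolynomial σ k) :
    coefL l (P * map (algebraMap k K) Q) = coefL l P * Q := by
  classical
  ext m
  rw [coeff_coefL, coeff_mul, coeff_mul, map_sum]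
  refine Finset.sum_congr rfl fun x _ => ?_
  rw [coeff_map, coeff_coefL, mul_comm, ← Algebra.smul_def, map_smul, smul_eq_mul, mul_comm]

lemma coefL_C {k K σ : Type*} [Field k] [Field K] [Algebra k K] (l : K →ₗ[k] k)
    (c : K) : coefL (σ := σ) l (C c) = C (l c) := by
  classical
  ext m
  rw [coeff_coefL, coeff_C, coeff_C]
  split_ifs <;> simp

lemma descent {k K σ F E : Type*} [Field k] [Field K] [Algebra k K] [Field F] [Field E]
    [Algebra k F]
    [Algebra (MvPolynomial σ k) F] [IsFractionRing (MvPolynomial σ k) F]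
    [Algebra (MvPolynomial σ K) E] [IsFractionRing (MvPolynomial σ K) E]
    (hkF : ∀ c : k, algebraMap k F c = algebraMap (MvPolynomial σ k) F (C c))
    (j : F →+* E) (hj : ∀ P : MvPolynomial σ k, j (algebraMap _ _ P) = algebraMap _ E (map (algebraMap k K) P))
    (F' : IntermediateField k F) (f : F)
    (hf : j f ∈ AddSubgroup.closure
      {w | ∃ c : K, ∃ a ∈ F', w = algebraMap (MvPolynomial σ K) E (C c) * j a}) : f ∈ F' := by
  obtain ⟨l, hl⟩ : ∃ l : K →ₗ[k] k, l 1 = 1 := by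
    obtain ⟨l, hl⟩ := LinearMap.exists_leftInverse_of_injective (Algebra.linearMap k K)
      (LinearMap.ker_eq_bot.2 (algebraMap k K).injective)
    exact ⟨l, by simpa using LinearMap.congr_fun hl 1⟩
  have main : ∀ z ∈ AddSubgroup.closure
      {w | ∃ c : K, ∃ a ∈ F', w = algebraMap (MvPolynomial σ K) E (C c) * j a},
      ∃ D : MvPolynomial σ k, D ≠ 0 ∧ ∃ Q : MvPolynomial σ K,
        z * j (algebraMap _ _ D) = algebraMap _ _ Q ∧
        algebraMap _ F (coefL l Q) / algebraMap _ F D ∈ F' := by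
    intro z hz
    have hne : ∀ D : MvPolynomial σ k, D ≠ 0 → algebraMap _ F D ≠ 0 := fun D hD h =>
      hD (IsFractionRing.injective _ F (by rw [h, map_zero]))
    induction hz using AddSubgroup.closure_induction with
    | mem x hx =>
      obtain ⟨c, a, ha, rfl⟩ := hx
      obtain ⟨n, e, he, rfl⟩ := IsFractionRing.div_surjective (A := MvPolynomial σ k) a
      have he0 : e ≠ 0 := nonZeroDivisors.ne_zero he
      refine ⟨e, he0, C c * map (algebraMap k K) n, ?_, ?_⟩
      · rw [mul_assoc, ← map_mul j, div_mul_cancel₀ _ (hne e he0), hj, map_mul]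
      · rw [coefL_mul, coefL_C, map_mul, ← hkF, mul_div_assoc]
        exact mul_mem (F'.algebraMap_mem _) ha
    | zero => exact ⟨1, one_ne_zero, 0, by simp, by simp [coefL_zero]⟩
    | add x y _ _ hx hy =>
      obtain ⟨D, hD, Q, h1, h2⟩ := hx
      obtain ⟨D', hD', Q', h1', h2'⟩ := hy
      refine ⟨D * D', mul_ne_zero hD hD', Q * map (algebraMap k K) D' + Q' * map (algebraMap k K) D, ?_, ?_⟩
      · simp only [map_mul, map_add, ← h1, ← h1', hj]; ring
      · have := add_mem h2 h2'
        rw [div_add_div _ _ (hne D hD) (hne D' hD')] at this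
        rw [coefL_add, coefL_mul, coefL_mul]
        convert this using 2
        · simp only [map_mul, map_add]; ring
        · simp
    | neg x _ hx =>
      obtain ⟨D, hD, Q, h1, h2⟩ := hx
      refine ⟨D, hD, -Q, by rw [map_neg, ← h1]; ring, ?_⟩
      rw [coefL_neg, map_neg, neg_div]; exact neg_mem h2
  have hne : ∀ D : MvPolynomial σ k, D ≠ 0 → algebraMap _ F D ≠ 0 := fun D hD h =>
      hD (IsFractionRing.injective _ F (by rw [h, map_zero]))
  obtain ⟨D, hD, Q, h1, h2⟩ := main _ hf
  obtain ⟨n, e, he, rfl⟩ := IsFractionRing.div_surjective (A := MvPolynomial σ k) f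
  have he0 : e ≠ 0 := nonZeroDivisors.ne_zero he
  have h3 : map (algebraMap k K) (n * D) = Q * map (algebraMap k K) e := by
    apply IsFractionRing.injective _ E
    rw [map_mul _ Q, ← h1, ← hj, ← hj, mul_assoc, ← map_mul, ← map_mul]
    congr 1
    rw [map_mul]
    field_simp [hne e he0]
  have h4 : n * D = coefL l Q * e := by
    rw [← coefL_mul, ← h3]
    ext m
    rw [coeff_coefL, coeff_map, Algebra.algebraMap_eq_smul_one, map_smul, hl, smul_eq_mul, mul_one]
  have h5 := congrArg (algebraMap _ F) h4
  rw [map_mul, map_mul] at h5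
  convert h2 using 1
  rw [div_eq_div_iff (hne e he0) (hne D hD), h5]

lemma mAct_pow_succ (M : Matrix (Fin N) (Fin N) k) (n : ℕ) (P : MvPolynomial (Fin N) k) :
    mAct M (mAct (M ^ n) P) = mAct (M ^ (n + 1)) P := by
  rw [← AlgHom.comp_apply, mAct_comp, pow_succ]

lemma mAct_pow_inv (M : Matrix (Fin N) (Fin N) k) (P : MvPolynomial (Fin N) k)
    (h : mAct M P = P) (n : ℕ) : mAct (M ^ n) P = P := by
  induction n with
  | zero => rw [pow_zero, mAct_one]; rfl
  | succ n ih => rw [← mAct_pow_succ, ih, h]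

lemma mAct_pow_eig (M : Matrix (Fin N) (Fin N) k) (P : MvPolynomial (Fin N) k) (c : k)
    (h : mAct M P = C c * P) (n : ℕ) : mAct (M ^ n) P = C (c ^ n) * P := by
  induction n with
  | zero => rw [pow_zero, mAct_one]; simp
  | succ n ih =>
    rw [← mAct_pow_succ, ih, map_mul, h, ← algebraMap_eq, AlgHom.commutes, pow_succ, map_mul]
    ring

lemma mAct_C (M : Matrix (Fin N) (Fin N) k) (c : k) : mAct M (C c) = C c :=
  (mAct M).commutes c

lemma mAct_linear_deg (M : Matrix (Fin N) (Fin N) k) (i : Fin N) :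
    (mAct M (X i)).totalDegree ≤ 1 := by
  rw [mAct, aeval_X]
  refine totalDegree_finsetSum_le fun j _ => ?_
  refine (totalDegree_mul _ _).trans ?_
  rw [totalDegree_C, zero_add]
  exact (totalDegree_X j).le

lemma totalDegree_mAct_le (M : Matrix (Fin N) (Fin N) k) (P : MvPolynomial (Fin N) k) :
    (mAct M P).totalDegree ≤ P.totalDegree := by
  conv_lhs => rw [P.as_sum, map_sum]
  refine totalDegree_finsetSum_le fun m hm => ?_
  refine le_trans ?_ (le_totalDegree hm)
  rw [mAct, aeval_monomial]
  refine (totalDegree_mul _ _).trans ?_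
  rw [algebraMap_eq, totalDegree_C, zero_add]
  refine (totalDegree_finsetProd _ _).trans ?_
  refine Finset.sum_le_sum fun i _ => ?_
  refine (totalDegree_pow _ _).trans ?_
  have := mAct_linear_deg M i
  rw [mAct, aeval_X] at this
  nlinarith

/-- averaging -/
def avg (p : ℕ) (M : Matrix (Fin N) (Fin N) k) (P : MvPolynomial (Fin N) k) :
    MvPolynomial (Fin N) k := C ((p : k)⁻¹) * ∑ n ∈ Finset.range p, mAct (M ^ n) P

lemma avg_inv (p : ℕ) (M : Matrix (Fin N) (Fin N) k) (hM : M ^ p = 1)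
    (P : MvPolynomial (Fin N) k) : mAct M (avg p M P) = avg p M P := by
  rw [avg, map_mul, mAct_C, map_sum]
  refine congrArg (fun z => C ((p : k)⁻¹) * z) ?_
  simp only [mAct_pow_succ]
  have h1 := Finset.sum_range_succ' (fun n => mAct (M ^ n) P) p
  rw [Finset.sum_range_succ, hM, pow_zero] at h1
  rw [add_right_cancel h1]

lemma avg_of_inv (p : ℕ) (hp : (p : k) ≠ 0) (M : Matrix (Fin N) (Fin N) k)
    (P : MvPolynomial (Fin N) k) (h : mAct M P = P) : avg p M P = P := by
  simp only [avg, mAct_pow_inv M P h]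
  rw [Finset.sum_const, Finset.card_range, nsmul_eq_mul, ← mul_assoc, ← map_natCast C, ← map_mul,
    inv_mul_cancel₀ hp, map_one, one_mul]

lemma avg_deg (p : ℕ) (M : Matrix (Fin N) (Fin N) k)
    (P : MvPolynomial (Fin N) k) : (avg p M P).totalDegree ≤ P.totalDegree := by
  refine (totalDegree_mul _ _).trans ?_
  rw [totalDegree_C, zero_add]
  exact totalDegree_finsetSum_le fun j _ => totalDegree_mAct_le _ _

lemma avg_add (p : ℕ) (M : Matrix (Fin N) (Fin N) k) (P Q : MvPolynomial (Fin N) k) :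
    avg p M (P + Q) = avg p M P + avg p M Q := by
  simp only [avg, map_add, Finset.sum_add_distrib, mul_add]

lemma avg_zero (p : ℕ) (M : Matrix (Fin N) (Fin N) k) : avg p M 0 = 0 := by
  simp [avg]

lemma avg_C_mul (p : ℕ) (M : Matrix (Fin N) (Fin N) k) (c : k) (P : MvPolynomial (Fin N) k) :
    avg p M (C c * P) = C c * avg p M P := by
  simp only [avg, map_mul, mAct_C, ← Finset.mul_sum]
  ring

lemma map_mAct {K : Type} [Field K] [Algebra k K] (M : Matrix (Fin N) (Fin N) k)
    (P : MvPolynomial (Fin N) k) :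
    map (algebraMap k K) (mAct M P) = mAct (M.map (algebraMap k K)) (map (algebraMap k K) P) := by
  induction P using MvPolynomial.induction_on with
  | C a => simp
  | add p q hp hq => simp [hp, hq]
  | mul_X p i hp =>
    simp only [map_mul, hp, map_X]
    simp [mAct]

lemma map_avg {K : Type} [Field K] [Algebra k K] (p : ℕ) (M : Matrix (Fin N) (Fin N) k)
    (P : MvPolynomial (Fin N) k) :
    map (algebraMap k K) (avg p M P) = avg p (M.map (algebraMap k K)) (map (algebraMap k K) P) := by
  have : ∀ n, (M ^ n).map (algebraMap k K) = (M.map (algebraMap k K)) ^ n := fun n =>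
    map_pow (algebraMap k K).mapMatrix M n
  simp only [avg, map_mul, map_sum, map_mAct, map_C, map_inv₀, map_natCast, this]

lemma short_mem {K E : Type} [Field K] [Algebra k K] [Field E]
    (θ : MvPolynomial (Fin N) K →+* E) (L : Subfield E) (p : ℕ) (hp : (p : k) ≠ 0)
    (M : Matrix (Fin N) (Fin N) k) (hM : M ^ p = 1) (hC : ∀ c, θ (C c) ∈ L)
    (hk : ∀ P : MvPolynomial (Fin N) k, mAct M P = P → 2 * P.totalDegree ≤ p + 3 →
      θ (map (algebraMap k K) P) ∈ L)
    (Z : MvPolynomial (Fin N) K) (hZ : mAct (M.map (algebraMap k K)) Z = Z)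
    (hd : 2 * Z.totalDegree ≤ p + 3) : θ Z ∈ L := by
  have hp' : (p : K) ≠ 0 := by
    rw [← map_natCast (algebraMap k K), map_ne_zero]; exact hp
  rw [← avg_of_inv p hp' _ Z hZ]
  have : ∀ s ⊆ Z.support, θ (avg p (M.map (algebraMap k K)) (∑ m ∈ s, monomial m (coeff m Z))) ∈ L := by
    intro s
    induction s using Finset.cons_induction with
    | empty => simp [avg_zero]
    | cons m s hm ih =>
      intro hs
      rw [Finset.sum_cons, avg_add, map_add]
      refine add_mem ?_ (ih fun x hx => hs (by simp [hx]))
      have : (monomial m (coeff m Z) : MvPolynomial (Fin N) K) =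
          C (coeff m Z) * map (algebraMap k K) (monomial m 1) := by
        rw [map_monomial, C_mul_monomial]; simp
      rw [this, avg_C_mul, ← map_avg, map_mul]
      refine mul_mem (hC _) (hk _ (avg_inv p M hM _) ?_)
      have h1 := avg_deg p M (monomial m (1 : k))
      rw [totalDegree_monomial _ one_ne_zero] at h1
      have h2 : (m.sum fun _ e => e) ≤ Z.totalDegree := le_totalDegree (hs (by simp))
      omega
  have := this _ subset_rfl
  rwa [← Z.as_sum] at this

/-- eigen projections -/
def eproj (p : ℕ) (M : Matrix (Fin N) (Fin N) k) (ζ : k) (j : ℕ) (P : MvPolynomial (Fin N) k) :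
    MvPolynomial (Fin N) k :=
  C ((p : k)⁻¹) * ∑ n ∈ Finset.range p, C ((ζ⁻¹) ^ (j * n)) * mAct (M ^ n) P

lemma eproj_eig (p : ℕ) (M : Matrix (Fin N) (Fin N) k) (hM : M ^ p = 1) (ζ : k) (hζ0 : ζ ≠ 0)
    (hζ : ζ ^ p = 1) (j : ℕ) (P : MvPolynomial (Fin N) k) :
    mAct M (eproj p M ζ j P) = C (ζ ^ j) * eproj p M ζ j P := by
  rw [eproj, map_mul, mAct_C, map_sum, mul_left_comm]
  congr 1
  have h1 := Finset.sum_range_succ' (fun n => C ((ζ⁻¹) ^ (j * n)) * mAct (M ^ n) P) p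
  rw [Finset.sum_range_succ, hM, pow_zero, mul_comm j p, pow_mul, inv_pow, hζ, inv_one, one_pow,
    mul_zero, pow_zero] at h1
  rw [add_right_cancel h1, Finset.mul_sum]
  refine Finset.sum_congr rfl fun n _ => ?_
  rw [map_mul, mAct_C, mAct_pow_succ, ← mul_assoc, ← map_mul, mul_add, mul_one, pow_add ζ⁻¹,
    mul_left_comm, ← mul_pow, mul_inv_cancel₀ hζ0, one_pow, mul_one]

lemma eproj_sum (p : ℕ) (hp : p.Prime) (hpk : (p : k) ≠ 0) (M : Matrix (Fin N) (Fin N) k) (ζ : k)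
    (hζ : IsPrimitiveRoot ζ p) (P : MvPolynomial (Fin N) k) :
    ∑ j ∈ Finset.range p, eproj p M ζ j P = P := by
  simp only [eproj]
  rw [← Finset.mul_sum, Finset.sum_comm]
  have h : ∀ n ∈ Finset.range p, ∑ j ∈ Finset.range p, C ((ζ⁻¹) ^ (j * n)) * mAct (M ^ n) P =
      if n = 0 then C (p : k) * P else 0 := by
    intro n hn
    rw [← Finset.sum_mul, ← map_sum]
    split_ifs with h0
    · subst h0; simp [mAct_one]
    · have h1 : IsPrimitiveRoot (ζ⁻¹ ^ n) p := by
        apply hζ.inv.pow_of_coprime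
        exact (Nat.coprime_comm.1 ((Nat.Prime.coprime_iff_not_dvd hp).2
          (Nat.not_dvd_of_pos_of_lt (Nat.pos_of_ne_zero h0) (Finset.mem_range.1 hn))))
      have h2 := h1.geom_sum_eq_zero hp.one_lt
      have h3 : ∑ j ∈ Finset.range p, ζ⁻¹ ^ (j * n) = 0 := by
        rw [← h2]
        refine Finset.sum_congr rfl fun j _ => ?_
        rw [mul_comm, pow_mul]
      rw [h3, map_zero, zero_mul]
  rw [Finset.sum_congr rfl h, Finset.sum_ite_eq', if_pos (Finset.mem_range.2 hp.pos), ← mul_assoc,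
    ← map_mul, inv_mul_cancel₀ hpk, map_one, one_mul]

lemma eproj_deg (p : ℕ) (M : Matrix (Fin N) (Fin N) k) (ζ : k) (j : ℕ)
    (P : MvPolynomial (Fin N) k) : (eproj p M ζ j P).totalDegree ≤ P.totalDegree := by
  refine (totalDegree_mul _ _).trans ?_
  rw [totalDegree_C, zero_add]
  refine totalDegree_finsetSum_le fun j _ => ?_
  refine (totalDegree_mul _ _).trans ?_
  rw [totalDegree_C, zero_add]
  exact totalDegree_mAct_le _ _

/-- eigenform -/
def IsEF (p : ℕ) (M : Matrix (Fin N) (Fin N) k) (ζ : k) (y : MvPolynomial (Fin N) k) (a : ℕ) :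
    Prop := y ≠ 0 ∧ y.totalDegree ≤ 1 ∧ a < p ∧ mAct M y = C (ζ ^ a) * y

lemma adjoin_EF (p : ℕ) (hp : p.Prime) (hpk : (p : k) ≠ 0) (M : Matrix (Fin N) (Fin N) k)
    (hM : M ^ p = 1) (ζ : k) (hζ : IsPrimitiveRoot ζ p) :
    Algebra.adjoin k {y | ∃ a, IsEF p M ζ y a} = ⊤ := by
  rw [eq_top_iff, ← MvPolynomial.adjoin_range_X, Algebra.adjoin_le_iff]
  rintro _ ⟨i, rfl⟩
  rw [SetLike.mem_coe, ← eproj_sum p hp hpk M ζ hζ (X i)]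
  refine sum_mem fun j hj => ?_
  by_cases h0 : eproj p M ζ j (X i) = 0
  · rw [h0]; exact zero_mem _
  · refine Algebra.subset_adjoin ⟨j, h0, (eproj_deg _ _ _ _ _).trans (totalDegree_X i).le,
      Finset.mem_range.1 hj, eproj_eig p M hM ζ (hζ.ne_zero hp.ne_zero) hζ.pow_eq_one _ _⟩

lemma inv_in_L {E : Type} [Field E] (θ : MvPolynomial (Fin N) k →+* E)
    (hθ : Function.Injective θ) (L : Subfield E)
    (p : ℕ) (hp : p.Prime) (hpk : (p : k) ≠ 0)
    (M : Matrix (Fin N) (Fin N) k) (hM : M ^ p = 1) (ζ : k) (hζ : IsPrimitiveRoot ζ p)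
    (hC : ∀ c, θ (C c) ∈ L)
    (hk : ∀ P : MvPolynomial (Fin N) k, mAct M P = P → 2 * P.totalDegree ≤ p + 3 → θ P ∈ L)
    (s t : MvPolynomial (Fin N) k) (b : ℕ) (hs : IsEF p M ζ s 1) (ht : IsEF p M ζ t b)
    (hb : 2 ≤ b) (hbp : b + 2 ≤ p)
    (Z : MvPolynomial (Fin N) k) (hZ : mAct M Z = Z) : θ Z ∈ L := by
  have hne : ∀ y, y ≠ 0 → θ y ≠ 0 := fun y h => (map_ne_zero_iff θ hθ).2 h
  let H : Subgroup Eˣ :=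
    { carrier := {u | (u : E) ∈ L}
      mul_mem' := fun {a b} ha hb => by
        simp only [Set.mem_ofPred_eq, Units.val_mul] at *; exact mul_mem ha hb
      one_mem' := by simp
      inv_mem' := fun {a} ha => by
        simp only [Set.mem_ofPred_eq, Units.val_inv_eq_inv_val] at *; exact inv_mem ha }
  let Y := {y : MvPolynomial (Fin N) k × ℕ // IsEF p M ζ y.1 y.2}
  let ε : Y → Eˣ := fun y => Units.mk0 (θ y.1.1) (hne _ y.2.1)
  let e : Y → Eˣ ⧸ H := fun y => QuotientGroup.mk (ε y)
  have hmk : ∀ u : Eˣ, (QuotientGroup.mk u : Eˣ ⧸ H) = 1 ↔ (u : E) ∈ L := fun u =>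
    QuotientGroup.eq_one_iff u
  have hshort : ∀ (s t : Y) (x y : ℕ), 2 * (x + y) ≤ p + 3 → p ∣ s.1.2 * x + t.1.2 * y →
      e s ^ x * e t ^ y = 1 := by
    rintro ⟨⟨s, a⟩, hs⟩ ⟨⟨t, b⟩, ht⟩ x y hxy hdvd
    have : θ (s ^ x * t ^ y) ∈ L := by
      apply hk
      · rw [map_mul, map_pow, map_pow, hs.2.2.2, ht.2.2.2, mul_pow, mul_pow, mul_mul_mul_comm,
          ← map_pow, ← map_pow, ← map_mul, ← pow_mul, ← pow_mul, ← pow_add]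
        obtain ⟨q, hq⟩ := hdvd
        simp only at hq
        rw [hq, pow_mul, hζ.pow_eq_one, one_pow, map_one, one_mul]
      · have h1 := totalDegree_mul (s ^ x) (t ^ y)
        have h2 := totalDegree_pow s x
        have h3 := totalDegree_pow t y
        have h4 := Nat.mul_le_mul_left x hs.2.1
        have h5 := Nat.mul_le_mul_left y ht.2.1
        simp only at h4 h5
        omega
    have h6 := (hmk (ε ⟨⟨s, a⟩, hs⟩ ^ x * ε ⟨⟨t, b⟩, ht⟩ ^ y)).2 (by simpa [ε] using this)
    simpa using h6
  have hall := fun y : Y => all_letters p hp e (fun y => y.1.2) hshort ⟨⟨s, 1⟩, hs⟩ ⟨⟨t, b⟩, ht⟩ rfl hb hbp y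
    y.2.2.2.1
  -- class of u^p is 1
  have hup : e ⟨⟨s, 1⟩, hs⟩ ^ p = 1 := by
    refine (two_letter p b hp hb hbp (e ⟨⟨s, 1⟩, hs⟩) (e ⟨⟨t, b⟩, ht⟩) fun x y h1 h2 => ?_).2
    exact hshort _ _ x y h1 (by simpa using h2)
  have hmon : ∀ z ∈ Submonoid.closure {y | ∃ a, IsEF p M ζ y a}, ∃ a : ℕ, ∃ hz : z ≠ 0,
      mAct M z = C (ζ ^ a) * z ∧
      (QuotientGroup.mk (Units.mk0 (θ z) (hne _ hz)) : Eˣ ⧸ H) = e ⟨⟨s, 1⟩, hs⟩ ^ a := by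
    intro z hz
    induction hz using Submonoid.closure_induction with
    | mem y hy =>
      obtain ⟨a, ha⟩ := hy
      exact ⟨a, ha.1, ha.2.2.2, hall ⟨⟨y, a⟩, ha⟩⟩
    | one =>
      refine ⟨0, one_ne_zero, by simp, ?_⟩
      rw [pow_zero, hmk]; simp
    | mul y z _ _ hy hz =>
      obtain ⟨a, h1, h2, h3⟩ := hy
      obtain ⟨b, h1', h2', h3'⟩ := hz
      refine ⟨a + b, mul_ne_zero h1 h1', ?_, ?_⟩
      · rw [map_mul, h2, h2', pow_add, map_mul]; ring
      · rw [pow_add, ← h3, ← h3', ← QuotientGroup.mk_mul]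
        congr 1
        ext; simp
  have havg : ∀ z ∈ Submonoid.closure {y | ∃ a, IsEF p M ζ y a}, θ (avg p M z) ∈ L := by
    intro z hz
    obtain ⟨a, h1, h2, h3⟩ := hmon z hz
    by_cases hpa : p ∣ a
    · obtain ⟨q, rfl⟩ := hpa
      rw [pow_mul, hup, one_pow, hmk] at h3
      rw [pow_mul, hζ.pow_eq_one, one_pow, map_one, one_mul] at h2
      rw [avg_of_inv p hpk M z h2]
      exact h3
    · have h4 : IsPrimitiveRoot (ζ ^ a) p :=
        hζ.pow_of_coprime _ (Nat.coprime_comm.1 ((Nat.Prime.coprime_iff_not_dvd hp).2 hpa))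
      have : avg p M z = 0 := by
        rw [avg]
        simp only [mAct_pow_eig M z _ h2]
        rw [← Finset.sum_mul, ← map_sum, h4.geom_sum_eq_zero hp.one_lt]
        simp
      rw [this, map_zero]; exact zero_mem _
  have hZ' : Z ∈ Submodule.span k
      (Submonoid.closure {y | ∃ a, IsEF p M ζ y a} : Set (MvPolynomial (Fin N) k)) := by
    rw [← Algebra.adjoin_eq_span, adjoin_EF p hp hpk M hM ζ hζ]; simp
  rw [← avg_of_inv p hpk M Z hZ]
  clear hZ
  induction hZ' using Submodule.span_induction with
  | mem x hx => exact havg x hx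
  | zero => rw [avg_zero, map_zero]; exact zero_mem _
  | add x y _ _ hx hy => rw [avg_add, map_add]; exact add_mem hx hy
  | smul c x _ hx => rw [smul_eq_C_mul, avg_C_mul, map_mul]; exact mul_mem (hC c) hx

lemma fAct_algebraMap (M : GL (Fin N) k) (P : MvPolynomial (Fin N) k) :
    fAct M (algebraMap _ _ P) = algebraMap _ _ (mAct (M : Matrix (Fin N) (Fin N) k) P) := by
  rw [fAct, IsFractionRing.ringEquivOfRingEquiv_algebraMap]
  rfl

lemma inv_frac (M : GL (Fin N) k) (p : ℕ) (hp : 0 < p)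
    (hM : (M : Matrix (Fin N) (Fin N) k) ^ p = 1)
    (f : FractionRing (MvPolynomial (Fin N) k)) (hf : fAct M f = f) :
    ∃ P Q : MvPolynomial (Fin N) k, mAct (M : Matrix (Fin N) (Fin N) k) P = P ∧
      mAct (M : Matrix (Fin N) (Fin N) k) Q = Q ∧ f = algebraMap _ _ P / algebraMap _ _ Q := by
  obtain ⟨P, Q, hQ, rfl⟩ := IsFractionRing.div_surjective (A := MvPolynomial (Fin N) k) f
  have hQ0 : Q ≠ 0 := nonZeroDivisors.ne_zero hQ
  obtain ⟨q, rfl⟩ : ∃ q, p = q + 1 := ⟨p - 1, by omega⟩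
  have hinj := IsFractionRing.injective (MvPolynomial (Fin N) k)
    (FractionRing (MvPolynomial (Fin N) k))
  have hne : ∀ D : MvPolynomial (Fin N) k, D ≠ 0 →
      algebraMap _ (FractionRing (MvPolynomial (Fin N) k)) D ≠ 0 := fun D hD =>
    (map_ne_zero_iff _ hinj).2 hD
  set A : Matrix (Fin N) (Fin N) k := (M : Matrix (Fin N) (Fin N) k) with hA
  set T := ∏ n ∈ Finset.range q, mAct (A ^ (n + 1)) Q with hT
  have hT0 : T ≠ 0 := by
    rw [hT, Finset.prod_ne_zero_iff]
    intro n _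
    have : mAct (A ^ (n + 1)) Q = mEquiv (M ^ (n + 1)) Q := by
      change _ = mAct ((M ^ (n + 1) : GL (Fin N) k) : Matrix (Fin N) (Fin N) k) Q
      rw [Units.val_pow_eq_pow_val]
    rw [this]
    simpa using hQ0
  have hQ' : mAct A (T * Q) = T * Q := by
    have h1 : T * Q = ∏ n ∈ Finset.range (q + 1), mAct (A ^ n) Q := by
      rw [Finset.prod_range_succ', pow_zero, mAct_one]; rfl
    rw [map_mul, hT, map_prod]
    simp only [mAct_pow_succ]
    rw [← hT, h1, Finset.prod_range_succ']
    have h2 := Finset.prod_range_succ' (fun n => mAct (A ^ (n + 1)) Q) q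
    rw [Finset.prod_range_succ, hM, zero_add, pow_one] at h2
    rw [← h2, pow_zero]
  have hfe : algebraMap _ (FractionRing (MvPolynomial (Fin N) k)) P / algebraMap _ _ Q =
      algebraMap _ _ (T * P) / algebraMap _ _ (T * Q) := by
    rw [map_mul, map_mul, mul_div_mul_left _ _ (hne T hT0)]
  refine ⟨T * P, T * Q, ?_, hQ', hfe⟩
  apply hinj
  rw [hfe, map_div₀, fAct_algebraMap, fAct_algebraMap, ← hA, hQ',
    div_left_inj' (hne _ (mul_ne_zero hT0 hQ0))] at hf
  exact hf

lemma isInv_poly (p : ℕ) [Fact p.Prime] (ρ : Multiplicative (ZMod p) →* GL (Fin N) k)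
    (P : MvPolynomial (Fin N) k)
    (h : mAct (ρ (Multiplicative.ofAdd 1) : Matrix (Fin N) (Fin N) k) P = P) :
    IsInv (fun g => ρ g) (algebraMap _ (FractionRing (MvPolynomial (Fin N) k)) P) := by
  intro g
  have hg : g = (Multiplicative.ofAdd (1 : ZMod p)) ^ (Multiplicative.toAdd g).val := by
    rw [← ofAdd_nsmul]; simp
  change fAct (ρ g) _ = _
  rw [hg, map_pow, fAct_algebraMap, Units.val_pow_eq_pow_val, mAct_pow_inv _ _ h]

lemma rdeg_poly (P : MvPolynomial (Fin N) k) (d : ℕ) (h : P.totalDegree ≤ d) :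
    RDegLE (algebraMap _ (FractionRing (MvPolynomial (Fin N) k)) P) d :=
  ⟨P, 1, one_ne_zero, fun _ _ h => isUnit_of_dvd_one h, by simp, by simpa using h⟩

lemma exists_form (R : Matrix (Fin N) (Fin N) k) (c : k) (v : Fin N → k) (hv : v ≠ 0)
    (h : R.mulVec v = c • v) :
    ∃ y : MvPolynomial (Fin N) k, y ≠ 0 ∧ y.totalDegree ≤ 1 ∧ mAct R y = C c * y := by
  have hdet : (R - c • (1 : Matrix (Fin N) (Fin N) k)).det = 0 := by
    rw [← Matrix.exists_mulVec_eq_zero_iff]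
    exact ⟨v, hv, by rw [Matrix.sub_mulVec, h, Matrix.smul_mulVec, Matrix.one_mulVec, sub_self]⟩
  obtain ⟨w, hw, hw'⟩ := Matrix.exists_vecMul_eq_zero_iff.2 hdet
  rw [Matrix.vecMul_sub, Matrix.vecMul_smul, Matrix.vecMul_one, sub_eq_zero] at hw'
  refine ⟨∑ i, C (w i) * X i, ?_, ?_, ?_⟩
  · intro h0
    apply hw
    funext i
    have := congrArg (coeff (Finsupp.single i 1)) h0
    simpa [coeff_sum, coeff_C_mul, coeff_X, Finsupp.single_left_inj] using this
  · refine totalDegree_finsetSum_le fun j _ => ?_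
    refine (totalDegree_mul _ _).trans ?_
    rw [totalDegree_C, zero_add]
    exact (totalDegree_X j).le
  · rw [map_sum, Finset.mul_sum]
    have : ∀ j, ∑ i, w i * R i j = c * w j := fun j => by
      have := congrFun hw' j
      simpa [Matrix.vecMul, dotProduct] using this
    simp only [map_mul, mAct_C, ← mul_assoc]
    simp only [← map_mul, ← this]
    simp only [mAct, aeval_X, Finset.mul_sum, map_sum, Finset.sum_mul, map_mul, mul_assoc]
    rw [Finset.sum_comm]

lemma occ_eig {K : Type} [Field K] [Algebra k K] (p : ℕ) [Fact p.Prime]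
    (ρ : Multiplicative (ZMod p) →* GL (Fin N) k) (χ : Multiplicative (ZMod p) →* Kˣ)
    (h : Occurs (fun g => ρ g) χ) :
    ∃ y : MvPolynomial (Fin N) K, y ≠ 0 ∧ y.totalDegree ≤ 1 ∧
      mAct ((ρ (Multiplicative.ofAdd 1) : Matrix (Fin N) (Fin N) k).map (algebraMap k K)) y =
      C (χ (Multiplicative.ofAdd 1) : K) * y := by
  obtain ⟨v, hv, h⟩ := h
  exact exists_form _ _ v hv (h _)

lemma char_ext {K : Type} [Field K] (p : ℕ) [Fact p.Prime]
    (χ ψ : Multiplicative (ZMod p) →* Kˣ)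
    (h : (χ (Multiplicative.ofAdd 1) : K) = ψ (Multiplicative.ofAdd 1)) : χ = ψ := by
  refine MonoidHom.ext fun g => Units.ext ?_
  have hg : g = (Multiplicative.ofAdd (1 : ZMod p)) ^ (Multiplicative.toAdd g).val := by
    rw [← ofAdd_nsmul]; simp
  rw [hg, map_pow, map_pow, Units.val_pow_eq_pow_val, Units.val_pow_eq_pow_val, h]

lemma gen_pow (p : ℕ) [Fact p.Prime] : (Multiplicative.ofAdd (1 : ZMod p)) ^ p = 1 := by
  rw [← ofAdd_nsmul]; simp

lemma two_chars {α : Type*} [Field α] (x y z : α) (hxy : x ≠ y) (hxz : x ≠ z) (hyz : y ≠ z)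
    (P : α → Prop) (hx : P x) (hy : P y) (hz : P z) (hx1 : x ≠ 1) (hy1 : y ≠ 1) (hz1 : z ≠ 1)
    (hx0 : x ≠ 0) :
    ∃ s t, P s ∧ P t ∧ s ≠ 1 ∧ t ≠ 1 ∧ s ≠ t ∧ s * t ≠ 1 := by
  by_cases h : x * y = 1
  · refine ⟨x, z, hx, hz, hx1, hz1, hxz, fun h' => hyz ?_⟩
    exact mul_left_cancel₀ hx0 (h.trans h'.symm)
  · exact ⟨x, y, hx, hy, hx1, hy1, hxy, h⟩

/-- Upper bound: for `G = ℤ/pℤ` with `p` prime, `char k ≠ p`, and `V` a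
representation whose base change to an algebraic closure contains at least `3` distinct
nontrivial characters, `β^r(G,V) ≤ (p+3)/2`. -/
theorem stmt17 {k : Type} [Field k] {N : ℕ} (p : ℕ) [Fact p.Prime]
    (hchar : (p : k) ≠ 0) (ρ : Multiplicative (ZMod p) →* GL (Fin N) k)
    (hocc : 3 ≤ {χ : Multiplicative (ZMod p) →* (AlgebraicClosure k)ˣ |
      χ ≠ 1 ∧ Occurs (fun g => ρ g) χ}.ncard) :
    2 * betaR (fun g => ρ g) ≤ p + 3 := by
  have hp : p.Prime := Fact.out
  let K := AlgebraicClosure k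
  let F := FractionRing (MvPolynomial (Fin N) k)
  let E := FractionRing (MvPolynomial (Fin N) K)
  set g0 : Multiplicative (ZMod p) := Multiplicative.ofAdd 1 with hg0
  have hg0p : g0 ^ p = 1 := gen_pow p
  set M : Matrix (Fin N) (Fin N) k := (ρ g0 : Matrix (Fin N) (Fin N) k) with hMdef
  have hM : M ^ p = 1 := by
    rw [hMdef, ← Units.val_pow_eq_pow_val, ← map_pow, hg0p, map_one]; rfl
  have hMK : (M.map (algebraMap k K)) ^ p = 1 := by
    have := map_pow (algebraMap k K).mapMatrix M p
    rw [hM, map_one] at this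
    exact this.symm
  have hpK : (p : K) ≠ 0 := by
    rw [← map_natCast (algebraMap k K), map_ne_zero]; exact hchar
  -- the two eigenvalues
  let Pr : K → Prop := fun c => c ^ p = 1 ∧ ∃ y : MvPolynomial (Fin N) K, y ≠ 0 ∧
    y.totalDegree ≤ 1 ∧ mAct (M.map (algebraMap k K)) y = C c * y
  have hPr : ∀ χ : Multiplicative (ZMod p) →* Kˣ, Occurs (fun g => ρ g) χ → Pr (χ g0 : K) := by
    intro χ hχ
    refine ⟨?_, occ_eig p ρ χ hχ⟩
    rw [← Units.val_pow_eq_pow_val, ← map_pow, hg0p, map_one, Units.val_one]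
  have hch1 : ∀ χ : Multiplicative (ZMod p) →* Kˣ, χ ≠ 1 → (χ g0 : K) ≠ 1 := by
    intro χ h h'
    exact h (char_ext p χ 1 (by rw [h', MonoidHom.one_apply, Units.val_one]))
  obtain ⟨ζ, ξ, ⟨hζp, s, hs0, hs1, hs2⟩, ⟨hξp, t, ht0, ht1, ht2⟩, hζ1, hξ1, hne, hmul⟩ :
      ∃ s t, Pr s ∧ Pr t ∧ s ≠ 1 ∧ t ≠ 1 ∧ s ≠ t ∧ s * t ≠ 1 := by
    have hfin := Set.finite_of_ncard_pos (lt_of_lt_of_le (by norm_num) hocc)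
    obtain ⟨x, y, z, hx, hy, hz, hxy, hxz, hyz⟩ := (Set.two_lt_ncard_iff hfin).1 hocc
    exact two_chars (x g0 : K) (y g0 : K) (z g0 : K) (fun h => hxy (char_ext p _ _ h))
      (fun h => hxz (char_ext p _ _ h)) (fun h => hyz (char_ext p _ _ h)) Pr
      (hPr _ hx.2) (hPr _ hy.2) (hPr _ hz.2) (hch1 _ hx.1) (hch1 _ hy.1) (hch1 _ hz.1)
      (Units.ne_zero _)
  have hζ : IsPrimitiveRoot ζ p := by
    rw [← orderOf_eq_prime hζp hζ1]; exact IsPrimitiveRoot.orderOf ζ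
  have : NeZero p := ⟨hp.ne_zero⟩
  obtain ⟨b, hbp, rfl⟩ := hζ.eq_pow_of_pow_eq_one hξp
  have hb0 : b ≠ 0 := by rintro rfl; exact hξ1 (pow_zero _)
  have hb1 : b ≠ 1 := by rintro rfl; exact hne (pow_one _).symm
  have hb2 : b + 1 ≠ p := by
    intro h; apply hmul; rw [← pow_succ', h, hζp]
  -- the fields
  let F' : IntermediateField k F :=
    IntermediateField.adjoin k {h | IsInv (fun g => ρ g) h ∧ RDegLE h ((p + 3) / 2)}
  let θ : MvPolynomial (Fin N) K →+* E := algebraMap _ _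
  have hθ : Function.Injective θ := IsFractionRing.injective _ _
  have hmapinj : Function.Injective (θ.comp (map (algebraMap k K))) :=
    hθ.comp (map_injective _ (algebraMap k K).injective)
  let j : F →+* E := IsFractionRing.lift hmapinj
  have hj : ∀ P : MvPolynomial (Fin N) k, j (algebraMap _ _ P) = θ (map (algebraMap k K) P) :=
    fun P => IsFractionRing.lift_algebraMap hmapinj P
  have hkF : ∀ c : k, algebraMap k F c = algebraMap (MvPolynomial (Fin N) k) F (C c) := fun c =>
    IsScalarTower.algebraMap_apply k (MvPolynomial (Fin N) k) F c
  obtain ⟨L, hL1, hL2, hL3⟩ := exists_compositum j (θ.comp C)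
    (fun c : k => by rw [hkF, hj, map_C]; rfl) F'
  have hk : ∀ P : MvPolynomial (Fin N) k, mAct M P = P → 2 * P.totalDegree ≤ p + 3 →
      θ (map (algebraMap k K) P) ∈ L := by
    intro P h1 h2
    rw [← hj]
    refine hL2 _ (IntermediateField.subset_adjoin _ _ ⟨isInv_poly p ρ P h1, rdeg_poly P _ ?_⟩)
    omega
  have hshort := short_mem θ L p hchar M hM hL1 hk
  have hall := inv_in_L θ hθ L p hp hpK _ hMK ζ hζ hL1 hshort s t b
    ⟨hs0, hs1, hp.one_lt, by rw [pow_one]; exact hs2⟩ ⟨ht0, ht1, hbp, ht2⟩ (by omega) (by omega)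
  have hpoly : ∀ P : MvPolynomial (Fin N) k, mAct M P = P → algebraMap _ F P ∈ F' := by
    intro P h
    refine descent hkF j hj F' _ (hL3 _ ?_)
    rw [hj]
    apply hall
    rw [← map_mAct, h]
  have hbeta : betaR (fun g => ρ g) ≤ (p + 3) / 2 := by
    refine Nat.sInf_le fun f hf => ?_
    obtain ⟨P, Q, hP, hQ, rfl⟩ := inv_frac (ρ g0) p hp.pos hM f (hf g0)
    exact div_mem (hpoly P hP) (hpoly Q hQ)
  omega
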